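/- arXiv:2309.05837 — 2 statements merged into one kernel-verified Lean document; each statement's English description precedes it below -/
import Mathlib

section
/- (Perfect Safety Filter, safety–performance separation, deterministic case) Let φ : X → U → U be a perfect safety filter, i.e., φ x u ∈ U^s(x) whenever U^s(x) is nonempty, and φ x u = u whenever u ∈ U^s(x). Then for every x₀ ∈ Ω*, the set of closed-loop state–control trajectories generated by safe policies equals the set generated by filtered arbitrary policies: { (fun t => (x_t, π x_t)) | π : X → U is safe from x₀, where x_{t+1} = f x_t (π x_t) } = { (fun t => (x_t, φ x_t (π x_t))) | π : X → U arbitrary, where x_{t+1} = f x_t (φ x_t (π x_t)) }. Consequently, for any cost functional on trajectories, the optimal cost over safe policies equals the optimal cost over all policies acting through the filter. -/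
/-- Closed-loop trajectory of the deterministic system `f` under policy `π` from `x₀`. -/
def trajd {X U : Type*} (f : X → U → X) (π : X → U) (x₀ : X) : ℕ → X
  | 0 => x₀
  | t + 1 => f (trajd f π x₀ t) (π (trajd f π x₀ t))

/-- `π` is safe from `x₀` if the closed-loop trajectory avoids `F` at all times. -/
def Safe {X U : Type*} (f : X → U → X) (F : Set X) (π : X → U) (x₀ : X) : Prop :=
  ∀ t : ℕ, trajd f π x₀ t ∉ F

/-- The maximal safe set: all states from which some policy is safe. -/
def maxSafe {X U : Type*} (f : X → U → X) (F : Set X) : Set X :=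
  {x | ∃ π : X → U, Safe f F π x}

/-- The safe control set `U^s(x)`. -/
def safeCtrl {X U : Type*} (f : X → U → X) (F : Set X) (x : X) : Set U :=
  {u | f x u ∈ maxSafe f F}

/-- State–control trajectories generated by safe policies from `x₀`. -/
def safeTrajs {X U : Type*} (f : X → U → X) (F : Set X) (x₀ : X) : Set (ℕ → X × U) :=
  {σ | ∃ π : X → U, Safe f F π x₀ ∧
    σ = fun t => (trajd f π x₀ t, π (trajd f π x₀ t))}

/-- State–control trajectories generated by arbitrary policies acting through filter `φ`. -/
def filtTrajs {X U : Type*} (f : X → U → X) (φ : X → U → U) (x₀ : X) : Set (ℕ → X × U) :=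
  {σ | ∃ π : X → U,
    σ = fun t => (trajd f (fun x => φ x (π x)) x₀ t,
      φ (trajd f (fun x => φ x (π x)) x₀ t) (π (trajd f (fun x => φ x (π x)) x₀ t)))}

/-- Restarting a closed-loop trajectory at its state at time `s` shifts time by `s`. -/
theorem trajd_trajd {X U : Type*} (f : X → U → X) (π : X → U) (x₀ : X) (s t : ℕ) :
    trajd f π (trajd f π x₀ s) t = trajd f π x₀ (s + t) := by
  induction t with
  | zero => rfl
  | succ t ih => rw [trajd, ih, ← Nat.add_assoc, trajd]

theorem Safe.trajd_mem_maxSafe {X U : Type*} {f : X → U → X} {F : Set X} {π : X → U} {x₀ : X}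
    (h : Safe f F π x₀) (t : ℕ) : trajd f π x₀ t ∈ maxSafe f F :=
  ⟨π, fun s => by rw [trajd_trajd]; exact h (t + s)⟩

theorem Safe.apply_mem_safeCtrl {X U : Type*} {f : X → U → X} {F : Set X} {π : X → U} {x₀ : X}
    (h : Safe f F π x₀) (t : ℕ) : π (trajd f π x₀ t) ∈ safeCtrl f F (trajd f π x₀ t) :=
  h.trajd_mem_maxSafe (t + 1)

theorem safeCtrl_nonempty {X U : Type*} {f : X → U → X} {F : Set X} {x : X}
    (hx : x ∈ maxSafe f F) : (safeCtrl f F x).Nonempty := by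
  obtain ⟨π, hπ⟩ := hx
  exact ⟨π x, hπ.apply_mem_safeCtrl 0⟩

theorem notMem_of_mem_maxSafe {X U : Type*} {f : X → U → X} {F : Set X} {x : X}
    (hx : x ∈ maxSafe f F) : x ∉ F := by
  obtain ⟨π, hπ⟩ := hx
  exact hπ 0

/-- A policy choosing safe controls whenever one exists is safe from every state of the
maximal safe set. -/
theorem safe_of_mem_safeCtrl {X U : Type*} {f : X → U → X} {F : Set X} {π : X → U} {x₀ : X}
    (hπ : ∀ x, (safeCtrl f F x).Nonempty → π x ∈ safeCtrl f F x) (hx₀ : x₀ ∈ maxSafe f F) :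
    Safe f F π x₀ := by
  have key (t : ℕ) : trajd f π x₀ t ∈ maxSafe f F := by
    induction t with
    | zero => exact hx₀
    | succ t ih => exact hπ _ (safeCtrl_nonempty ih)
  exact fun t => notMem_of_mem_maxSafe (key t)

/-- Policies agreeing along the trajectory of the first generate the same trajectory. -/
theorem trajd_congr {X U : Type*} {f : X → U → X} {π ρ : X → U} {x₀ : X}
    (h : ∀ t, ρ (trajd f π x₀ t) = π (trajd f π x₀ t)) (t : ℕ) :
    trajd f ρ x₀ t = trajd f π x₀ t := by
  induction t with
  | zero => rfl
  | succ t ih => simp only [trajd, ih, h]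

/-- Perfect Safety Filter (safety–performance separation, deterministic case):
for a perfect filter `φ` and any `x₀ ∈ Ω*`, the set of state–control trajectories
generated by safe policies equals the set generated by filtered arbitrary policies;
consequently, for any cost functional on trajectories, the optimal cost over safe
policies equals the optimal cost over all policies acting through the filter. -/
theorem stmt_4 {X U : Type*} [Nonempty X] [Nonempty U]
    (f : X → U → X) (F : Set X) (φ : X → U → U)
    (h1 : ∀ x : X, (safeCtrl f F x).Nonempty → ∀ u : U, φ x u ∈ safeCtrl f F x)
    (h2 : ∀ x : X, ∀ u ∈ safeCtrl f F x, φ x u = u)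
    (x₀ : X) (hx₀ : x₀ ∈ maxSafe f F) :
    safeTrajs f F x₀ = filtTrajs f φ x₀ ∧
    ∀ J : (ℕ → X × U) → ℝ,
      sInf (J '' safeTrajs f F x₀) = sInf (J '' filtTrajs f φ x₀) := by
  have key : safeTrajs f F x₀ = filtTrajs f φ x₀ := by
    ext σ
    constructor
    · rintro ⟨π, hπ, rfl⟩
      have hφ (t : ℕ) : φ (trajd f π x₀ t) (π (trajd f π x₀ t)) = π (trajd f π x₀ t) :=
        h2 _ _ (hπ.apply_mem_safeCtrl t)
      refine ⟨π, funext fun t => ?_⟩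
      rw [trajd_congr (ρ := fun x => φ x (π x)) hφ t, hφ t]
    · rintro ⟨π, rfl⟩
      exact ⟨fun x => φ x (π x), safe_of_mem_safeCtrl (fun x hx => h1 x hx (π x)) hx₀, rfl⟩
  exact ⟨key, fun J => by rw [key]⟩
end

section
/- (Universal Safety Filter Theorem) Let η₀ ∈ H with Δ η₀ (π_s η₀) ≥ 0. Suppose: (soundness) for all η, u, if Δ η u ≥ 0 then η ∉ F; (recursive certificate) for all η, u and all d ∈ D, if Δ η u ≥ 0 then Δ (f η u d) (π_s (f η u d)) ≥ 0; and (filter property) for all η, u, if Δ η (π_s η) ≥ 0 then Δ η (φ η u) ≥ 0. Then for every task policy π_task : H → U and every disturbance sequence d : ℕ → D, the filtered closed-loop trajectory η_0 = η₀, η_{t+1} = f η_t (φ η_t (π_task η_t)) (d t) satisfies η_t ∉ F and Δ η_t (π_s η_t) ≥ 0 for all t ≥ 0. -/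
/-- Closed-loop trajectory on information states of `f` under policy `π`,
initial information state `η₀`, and disturbance sequence `d`. -/
def traj {H U D : Type*} (f : H → U → D → H) (π : H → U) (η₀ : H) (d : ℕ → D) : ℕ → H
  | 0 => η₀
  | t + 1 => f (traj f π η₀ d t) (π (traj f π η₀ d t)) (d t)

/-- Universal Safety Filter Theorem: given a fallback policy `πs`, a safety monitor `Δ`
that is sound and recursively certified, and a filter `φ` preserving nonnegativity of the
monitor, if the initial information state passes the monitor check under the fallback,
then the filtered closed-loop trajectory avoids the failure set and keeps the monitor
check passing under the fallback at all times, for every task policy and disturbance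
sequence. -/
theorem stmt_5 {H U D : Type*} [Nonempty H] [Nonempty U] [Nonempty D]
    (f : H → U → D → H) (F : Set H) (πs : H → U) (Δ : H → U → ℝ) (φ : H → U → U)
    (hsound : ∀ (η : H) (u : U), Δ η u ≥ 0 → η ∉ F)
    (hrec : ∀ (η : H) (u : U), Δ η u ≥ 0 →
      ∀ d : D, Δ (f η u d) (πs (f η u d)) ≥ 0)
    (hfilt : ∀ (η : H) (u : U), Δ η (πs η) ≥ 0 → Δ η (φ η u) ≥ 0)
    (η₀ : H) (h0 : Δ η₀ (πs η₀) ≥ 0) :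
    ∀ πtask : H → U, ∀ d : ℕ → D, ∀ t : ℕ,
      traj f (fun η => φ η (πtask η)) η₀ d t ∉ F ∧
      Δ (traj f (fun η => φ η (πtask η)) η₀ d t)
        (πs (traj f (fun η => φ η (πtask η)) η₀ d t)) ≥ 0 := by
  intro πtask d t
  suffices h : Δ (traj f (fun η => φ η (πtask η)) η₀ d t)
      (πs (traj f (fun η => φ η (πtask η)) η₀ d t)) ≥ 0 from ⟨hsound _ _ h, h⟩
  induction t with
  | zero => exact h0
  | succ t ih => exact hrec _ _ (hfilt _ _ ih) (d t)
end
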